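/- Let N ≥ 4 and let p be an integer with (N−1)/3 ≤ p ≤ (2N+1)/3. On (ℂ²)^{⊗N} (matrices indexed by functions Fin N → Fin 2), define σ_p = ((3p+1−N)/(6p)) |0⋯0⟩⟨0⋯0| + ((2N−3p+1)/(6(N−p))) |1⋯1⟩⟨1⋯1| + (1/(6·C(N−2, p−1))) |w_p⟩⟨w_p|, where |w_p⟩ = Σ_{f : Fin N → Fin 2, Σ_j f(j) = p} |f⟩ is the unnormalized sum of all computational basis vectors of Hamming weight p. Then σ_p is a density operator (positive semidefinite with trace 1), rank σ_p ≤ 3, and the partial trace of σ_p over the last N−2 qubits equals M_B^{(2)} = (1/3)( |00⟩⟨00| + |11⟩⟨11| + |ψ₊⟩⟨ψ₊| ), where |ψ₊⟩ = (|01⟩ + |10⟩)/√2. -/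

import Mathlib

open Matrix ComplexOrder

/-- Identify `Fin N → Fin d` with `(Fin k → Fin d) × (Fin (N-k) → Fin d)`: combine an index
on the first `k` tensor factors with an index on the last `N - k` factors. -/
def appendIdx {N k d : ℕ} (x : Fin k → Fin d) (c : Fin (N - k) → Fin d) : Fin N → Fin d :=
  fun a => if h : (a : ℕ) < k then x ⟨a, h⟩
    else c ⟨(a : ℕ) - k, by have := a.isLt; omega⟩

/-- Partial trace over the last `N - k` tensor factors of a matrix on `(ℂ^d)^{⊗N}`:
`(tr_{k+1,…,N} M)(x, y) = Σ_c M((x,c),(y,c))`. -/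
noncomputable def ptrLast (N k d : ℕ) (M : Matrix (Fin N → Fin d) (Fin N → Fin d) ℂ) :
    Matrix (Fin k → Fin d) (Fin k → Fin d) ℂ :=
  fun x y => ∑ c : Fin (N - k) → Fin d, M (appendIdx x c) (appendIdx y c)

/-- The all-zeros computational basis vector `|0⋯0⟩` on `N` qubits. -/
def allZeroVec (N : ℕ) : (Fin N → Fin 2) → ℂ :=
  fun f => if f = fun _ => 0 then 1 else 0

/-- The all-ones computational basis vector `|1⋯1⟩` on `N` qubits. -/
def allOneVec (N : ℕ) : (Fin N → Fin 2) → ℂ :=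
  fun f => if f = fun _ => 1 then 1 else 0

/-- The unnormalized vector `|w_p⟩ = Σ_{weight(f) = p} |f⟩`, the sum of all computational
basis vectors of Hamming weight `p`. -/
def hammingVec (N p : ℕ) : (Fin N → Fin 2) → ℂ :=
  fun f => if (∑ j, (f j : ℕ)) = p then 1 else 0

/-- The state `σ_p = ((3p+1−N)/(6p)) |0⋯0⟩⟨0⋯0| + ((2N−3p+1)/(6(N−p))) |1⋯1⟩⟨1⋯1|
  + (1/(6·C(N−2,p−1))) |w_p⟩⟨w_p|` on `(ℂ²)^{⊗N}`. -/
noncomputable def sigmaP (N p : ℕ) : Matrix (Fin N → Fin 2) (Fin N → Fin 2) ℂ :=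
  (((3 * (p : ℂ) + 1 - N) / (6 * p)) •
      Matrix.vecMulVec (allZeroVec N) (star (allZeroVec N)))
  + (((2 * (N : ℂ) - 3 * p + 1) / (6 * ((N : ℂ) - p))) •
      Matrix.vecMulVec (allOneVec N) (star (allOneVec N)))
  + ((6 * (Nat.choose (N - 2) (p - 1) : ℂ))⁻¹ •
      Matrix.vecMulVec (hammingVec N p) (star (hammingVec N p)))

/-- The Bell-type state `|ψ₊⟩ = (|01⟩ + |10⟩)/√2` on two qubits. -/
noncomputable def psiPlusVec : (Fin 2 → Fin 2) → ℂ :=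
  fun g => ((if g = ![0, 1] then 1 else 0) + (if g = ![1, 0] then 1 else 0)) /
    (Real.sqrt 2 : ℂ)

/-- The 2-boson maximally mixed state
`M_B^{(2)} = (1/3)(|00⟩⟨00| + |11⟩⟨11| + |ψ₊⟩⟨ψ₊|)`. -/
noncomputable def twoBosonMaxMixed : Matrix (Fin 2 → Fin 2) (Fin 2 → Fin 2) ℂ :=
  (3 : ℂ)⁻¹ •
    (Matrix.vecMulVec (allZeroVec 2) (star (allZeroVec 2))
      + Matrix.vecMulVec (allOneVec 2) (star (allOneVec 2))
      + Matrix.vecMulVec psiPlusVec (star psiPlusVec))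

/-- The position of a subsystem, either among the first `k` factors or among the last `N - k`. -/
def splitEquiv {N k : ℕ} (h : k ≤ N) : Fin k ⊕ Fin (N - k) ≃ Fin N :=
  finSumFinEquiv.trans (finCongr (by omega))

theorem appendIdx_splitEquiv {N k d : ℕ} (h : k ≤ N) (x : Fin k → Fin d)
    (c : Fin (N - k) → Fin d) (s : Fin k ⊕ Fin (N - k)) :
    appendIdx x c (splitEquiv h s) = Sum.elim x c s := by
  rcases s with i | j <;> simp [appendIdx, splitEquiv]

theorem appendIdx_eq_const_iff {N k d : ℕ} (h : k ≤ N) (x : Fin k → Fin d)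
    (c : Fin (N - k) → Fin d) (a : Fin d) :
    (appendIdx x c = fun _ => a) ↔ (x = fun _ => a) ∧ c = fun _ => a := by
  simp only [funext_iff, ← (splitEquiv h).forall_congr_right, appendIdx_splitEquiv, Sum.forall,
    Sum.elim_inl, Sum.elim_inr]

theorem sum_appendIdx {N k d : ℕ} (h : k ≤ N) (x : Fin k → Fin d) (c : Fin (N - k) → Fin d) :
    ∑ j, (appendIdx x c j : ℕ) = ∑ i, (x i : ℕ) + ∑ j, (c j : ℕ) := by
  simp [← (splitEquiv h).sum_comp, appendIdx_splitEquiv]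

theorem trace_ptrLast {N k d : ℕ} (h : k ≤ N)
    (M : Matrix (Fin N → Fin d) (Fin N → Fin d) ℂ) : (ptrLast N k d M).trace = M.trace := by
  let e : (Fin k → Fin d) × (Fin (N - k) → Fin d) ≃ (Fin N → Fin d) :=
    (Equiv.sumArrowEquivProdArrow _ _ _).symm.trans ((splitEquiv h).arrowCongr (Equiv.refl _))
  have he : ∀ q, e q = appendIdx q.1 q.2 := fun q => funext fun a => by
    obtain ⟨s, rfl⟩ := (splitEquiv h).surjective a
    rw [appendIdx_splitEquiv]
    rcases s with i | j <;> simp [e, Equiv.sumArrowEquivProdArrow]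
  simp only [Matrix.trace, Matrix.diag_apply, ptrLast]
  rw [← e.sum_comp, Fintype.sum_prod_type]
  simp only [he]

theorem sum_ite_weight_eq (n m : ℕ) :
    (∑ c : Fin n → Fin 2, if ∑ j, (c j : ℕ) = m then (1 : ℂ) else 0) = n.choose m := by
  induction n generalizing m with
  | zero => cases m <;> simp
  | succ n ih =>
    rw [← (Fin.consEquiv fun _ => Fin 2).sum_comp, Fintype.sum_prod_type]
    cases m with
    | zero => simpa [Fin.sum_univ_succ] using ih 0
    | succ m =>
      rw [Fin.sum_univ_two]
      simp only [Fin.consEquiv_apply, Fin.sum_univ_succ, Fin.cons_zero,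
        Fin.cons_succ, Fin.val_zero, Fin.val_one, zero_add, add_comm 1, Nat.add_right_cancel_iff, ih,
        Nat.choose_succ_succ, Nat.cast_add]
      ring

theorem ptrLast_allZeroVec {N k : ℕ} (h : k ≤ N) :
    ptrLast N k 2 (vecMulVec (allZeroVec N) (star (allZeroVec N))) =
      vecMulVec (allZeroVec k) (star (allZeroVec k)) := by
  ext x y
  by_cases hx : x = fun _ => 0 <;> by_cases hy : y = fun _ => 0 <;>
    simp [ptrLast, vecMulVec_apply, allZeroVec, appendIdx_eq_const_iff h, hx, hy]

theorem ptrLast_allOneVec {N k : ℕ} (h : k ≤ N) :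
    ptrLast N k 2 (vecMulVec (allOneVec N) (star (allOneVec N))) =
      vecMulVec (allOneVec k) (star (allOneVec k)) := by
  ext x y
  by_cases hx : x = fun _ => 1 <;> by_cases hy : y = fun _ => 1 <;>
    simp [ptrLast, vecMulVec_apply, allOneVec, appendIdx_eq_const_iff h, hx, hy]

theorem ptrLast_hammingVec_apply {N k : ℕ} (h : k ≤ N) (p : ℕ) (x y : Fin k → Fin 2) :
    ptrLast N k 2 (vecMulVec (hammingVec N p) (star (hammingVec N p))) x y =
      if ∑ i, (x i : ℕ) = ∑ i, (y i : ℕ) ∧ ∑ i, (x i : ℕ) ≤ p then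
        ((N - k).choose (p - ∑ i, (x i : ℕ)) : ℂ) else 0 := by
  simp only [ptrLast, vecMulVec_apply, hammingVec, sum_appendIdx h, Pi.star_apply]
  split_ifs with hxy
  · rw [← sum_ite_weight_eq]
    refine Finset.sum_congr rfl fun c _ => ?_
    rw [← hxy.1]
    have hiff : ∑ i, (x i : ℕ) + ∑ j, (c j : ℕ) = p ↔
        ∑ j, (c j : ℕ) = p - ∑ i, (x i : ℕ) := by omega
    simp only [hiff]
    split_ifs <;> simp
  · refine Finset.sum_eq_zero fun c _ => ?_
    split_ifs <;> first | omega | simp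

theorem ptrLast_sigmaP {N : ℕ} (h : 2 ≤ N) (p : ℕ) :
    ptrLast N 2 2 (sigmaP N p) =
      ((3 * (p : ℂ) + 1 - N) / (6 * p)) • vecMulVec (allZeroVec 2) (star (allZeroVec 2))
      + ((2 * (N : ℂ) - 3 * p + 1) / (6 * ((N : ℂ) - p))) •
        vecMulVec (allOneVec 2) (star (allOneVec 2))
      + (6 * ((N - 2).choose (p - 1) : ℂ))⁻¹ •
        ptrLast N 2 2 (vecMulVec (hammingVec N p) (star (hammingVec N p))) := by
  rw [← ptrLast_allZeroVec h, ← ptrLast_allOneVec h]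
  ext x y
  simp [ptrLast, sigmaP, Finset.sum_add_distrib, Finset.mul_sum]

theorem inv_sqrt_two_mul_self : ((√2 : ℝ) : ℂ)⁻¹ * ((√2 : ℝ) : ℂ)⁻¹ = 2⁻¹ := by
  rw [← mul_inv, ← Complex.ofReal_mul, Real.mul_self_sqrt zero_le_two, Complex.ofReal_ofNat]

theorem ptrLast_sigmaP_eq_twoBosonMaxMixed {N p : ℕ} (hp : 0 < p) (hpN : p < N) :
    ptrLast N 2 2 (sigmaP N p) = twoBosonMaxMixed := by
  have hp0 : (p : ℂ) ≠ 0 := by exact_mod_cast hp.ne'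
  have hNp : (N : ℂ) - p ≠ 0 := sub_ne_zero.2 (by exact_mod_cast hpN.ne')
  have hC : ((N - 2).choose (p - 1) : ℂ) ≠ 0 := by
    exact_mod_cast (Nat.choose_pos (by omega)).ne'
  have hup : ((N - 2).choose p : ℂ) * p = (N - 2).choose (p - 1) * (N - 1 - p) := by
    have := Nat.choose_succ_right_eq (N - 2) (p - 1)
    rw [Nat.sub_add_cancel hp] at this
    have hcast : ((N - 2 - (p - 1) : ℕ) : ℂ) = N - 1 - p := by
      rw [show N - 2 - (p - 1) = N - (1 + p) by omega, Nat.cast_sub (by omega)]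
      push_cast
      ring
    rw [← hcast]
    exact_mod_cast this
  have hdown : (if 2 ≤ p then ((N - 2).choose (p - 2) : ℂ) else 0) * (N - p) =
      (N - 2).choose (p - 1) * (p - 1) := by
    split_ifs with h2
    · have := Nat.choose_succ_right_eq (N - 2) (p - 2)
      rw [show p - 2 + 1 = p - 1 by omega, show N - 2 - (p - 2) = N - p by omega] at this
      rw [← Nat.cast_sub hpN.le, ← Nat.cast_pred hp]
      exact_mod_cast this.symm
    · obtain rfl : p = 1 := by omega
      simp
  have h00 : (3 * (p : ℂ) + 1 - N) / (6 * p) +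
      (6 * ((N - 2).choose (p - 1) : ℂ))⁻¹ * (N - 2).choose p = 3⁻¹ := by
    rw [eq_div_of_mul_eq hp0 hup]
    field_simp
    ring
  have h11 : (2 * (N : ℂ) - 3 * p + 1) / (6 * ((N : ℂ) - p)) +
      (6 * ((N - 2).choose (p - 1) : ℂ))⁻¹ *
        (if 2 ≤ p then ((N - 2).choose (p - 2) : ℂ) else 0) = 3⁻¹ := by
    rw [eq_div_of_mul_eq hNp hdown]
    field_simp
    ring
  have h01 : (6 * ((N - 2).choose (p - 1) : ℂ))⁻¹ * (N - 2).choose (p - 1) = 3⁻¹ * 2⁻¹ := by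
    field_simp
    norm_num
  have hone : 1 ≤ p := hp
  simp only [mul_ite, mul_zero] at h11
  rw [ptrLast_sigmaP (by omega)]
  generalize (6 * ((N - 2).choose (p - 1) : ℂ))⁻¹ = K at h00 h01 h11 ⊢
  ext x y
  obtain ⟨a, b, rfl⟩ : ∃ a b, x = ![a, b] := ⟨x 0, x 1, by ext i; fin_cases i <;> rfl⟩
  obtain ⟨c, d, rfl⟩ : ∃ c d, y = ![c, d] := ⟨y 0, y 1, by ext i; fin_cases i <;> rfl⟩
  simp only [Matrix.add_apply, Matrix.smul_apply, smul_eq_mul, vecMulVec_apply, Pi.star_apply,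
    ptrLast_hammingVec_apply (show 2 ≤ N by omega), twoBosonMaxMixed, allZeroVec, allOneVec,
    psiPlusVec, Fin.sum_univ_two]
  fin_cases a <;> fin_cases b <;> fin_cases c <;> fin_cases d <;>
    simp [funext_iff, Fin.forall_fin_two, hone, h00, h11, h01,
      inv_sqrt_two_mul_self]

theorem posSemidef_sigmaP {N p : ℕ} (hp : 0 < p) (hpN : p < N) (hp1 : N - 1 ≤ 3 * p)
    (hp2 : 3 * p ≤ 2 * N + 1) : (sigmaP N p).PosSemidef := by
  have hcoe0 : (0 : ℂ) ≤ (3 * (p : ℂ) + 1 - N) / (6 * p) := by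
    have : (0 : ℝ) ≤ (3 * (p : ℝ) + 1 - N) / (6 * p) := by
      refine div_nonneg (sub_nonneg.2 ?_) (by positivity)
      exact_mod_cast (by omega : N ≤ 3 * p + 1)
    simpa using Complex.zero_le_real.2 this
  have hcoe1 : (0 : ℂ) ≤ (2 * (N : ℂ) - 3 * p + 1) / (6 * ((N : ℂ) - p)) := by
    have hN : (p : ℝ) ≤ N := by exact_mod_cast hpN.le
    have h2 : 3 * (p : ℝ) ≤ 2 * N + 1 := by exact_mod_cast hp2
    have : (0 : ℝ) ≤ (2 * (N : ℝ) - 3 * p + 1) / (6 * ((N : ℝ) - p)) :=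
      div_nonneg (by linarith) (by linarith)
    simpa using Complex.zero_le_real.2 this
  have hcoew : (0 : ℂ) ≤ (6 * ((N - 2).choose (p - 1) : ℂ))⁻¹ := by positivity
  exact (((posSemidef_vecMulVec_self_star _).smul hcoe0).add
    ((posSemidef_vecMulVec_self_star _).smul hcoe1)).add
    ((posSemidef_vecMulVec_self_star _).smul hcoew)

theorem rank_add_le_rank_add_rank {m n K : Type*} [Fintype n] [Finite m] [Field K]
    (A B : Matrix m n K) : (A + B).rank ≤ A.rank + B.rank := by
  have := Fintype.ofFinite m
  rw [Matrix.rank, mulVecLin_add]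
  exact (Submodule.finrank_mono (LinearMap.range_add_le _ _)).trans
    (Submodule.finrank_add_le_finrank_add_finrank _ _)

theorem rank_sigmaP_le (N p : ℕ) : (sigmaP N p).rank ≤ 3 := by
  have h (a : ℂ) (v : (Fin N → Fin 2) → ℂ) : (a • vecMulVec v (star v)).rank ≤ 1 := by
    rw [← smul_vecMulVec]
    exact rank_vecMulVec_le _ _
  exact (rank_add_le_rank_add_rank _ _).trans
    (add_le_add ((rank_add_le_rank_add_rank _ _).trans (add_le_add (h _ _) (h _ _))) (h _ _))

theorem trace_twoBosonMaxMixed : twoBosonMaxMixed.trace = 1 := by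
  rw [Matrix.trace, ← (finTwoArrowEquiv (Fin 2)).symm.sum_comp, Fintype.sum_prod_type]
  simp [twoBosonMaxMixed, allZeroVec, allOneVec, psiPlusVec, vecMulVec_apply, Fin.sum_univ_two,
    funext_iff, Fin.forall_fin_two, finTwoArrowEquiv, inv_sqrt_two_mul_self]
  norm_num

/-- For `N ≥ 4` and `(N−1)/3 ≤ p ≤ (2N+1)/3`, the operator `σ_p` is a density operator of
rank at most `3` whose reduced state on the first two qubits is the 2-boson maximally mixed
state `M_B^{(2)} = (1/3)(|00⟩⟨00| + |11⟩⟨11| + |ψ₊⟩⟨ψ₊|)`. -/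
theorem sigmaP_density_rank_le_three_marginal
    (N p : ℕ) (hN : 4 ≤ N) (hp1 : N - 1 ≤ 3 * p) (hp2 : 3 * p ≤ 2 * N + 1) :
    ((sigmaP N p).PosSemidef ∧ (sigmaP N p).trace = 1) ∧
    (sigmaP N p).rank ≤ 3 ∧
    ptrLast N 2 2 (sigmaP N p) = twoBosonMaxMixed := by
  have hp : 0 < p := by omega
  have hpN : p < N := by omega
  have hmarg := ptrLast_sigmaP_eq_twoBosonMaxMixed hp hpN
  refine ⟨⟨posSemidef_sigmaP hp hpN hp1 hp2, ?_⟩, rank_sigmaP_le N p, hmarg⟩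
  rw [← trace_ptrLast (show 2 ≤ N by omega), hmarg, trace_twoBosonMaxMixed]
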